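/- arXiv:2207.03759 — 2 statements merged into one kernel-verified Lean document; each statement's English description precedes it below -/
import Mathlib

section
/- Let α ∈ k satisfy α^(q²) = α and α^q ≠ α, and let e ∈ k satisfy e^(q+1) = 1. Then there is a k-algebra field automorphism σ of F determined by σ(x) = ((α − e·α^q)·x − (1 − e)·α^(q+1)) / ((1 − e)·x + (−α^q + e·α)) and σ(y) = e²·(α^q − α)²·y / ((1 − e)·x + (−α^q + e·α))², and σ fixes the element u = (x − α)² / y. -/
open IntermediateField Polynomial

/-- An algebra homomorphism out of a field generated by quotients of values of `φ` is determined
by any `ψ` with the same kernel as `φ`. -/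
theorem exists_algHom_of_ker_eq {k R F L : Type*} [Field k] [CommRing R] [Algebra k R]
    [Field F] [Algebra k F] [Field L] [Algebra k L] (φ : R →ₐ[k] F) (ψ : R →ₐ[k] L)
    (hker : ∀ r, φ r = 0 ↔ ψ r = 0) (hfrac : ∀ z, ∃ a b, z = φ a / φ b) :
    ∃ σ : F →ₐ[k] L, ∀ r, σ (φ r) = ψ r := by
  let I := RingHom.ker φ
  let f : R ⧸ I →ₐ[k] F := Ideal.Quotient.liftₐ I φ fun r hr => hr
  let g : R ⧸ I →ₐ[k] L := Ideal.Quotient.liftₐ I ψ fun r hr => (hker r).1 hr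
  have hf : Function.Injective f := by
    rw [injective_iff_map_eq_zero]
    intro a
    obtain ⟨r, rfl⟩ := Ideal.Quotient.mk_surjective a
    exact fun h => Ideal.Quotient.eq_zero_iff_mem.2 h
  have hg : Function.Injective g := by
    rw [injective_iff_map_eq_zero]
    intro a
    obtain ⟨r, rfl⟩ := Ideal.Quotient.mk_surjective a
    exact fun h => Ideal.Quotient.eq_zero_iff_mem.2 ((hker r).2 h)
  let _ : Algebra (R ⧸ I) F := f.toRingHom.toAlgebra
  have : IsScalarTower k (R ⧸ I) F := .of_algebraMap_eq fun c => (f.commutes c).symm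
  have : FaithfulSMul (R ⧸ I) F := (faithfulSMul_iff_algebraMap_injective _ _).2 hf
  have : IsDomain (R ⧸ I) := hf.isDomain f.toRingHom
  have : IsFractionRing (R ⧸ I) F := .of_field _ _ fun z => by
    obtain ⟨a, b, h⟩ := hfrac z
    exact ⟨Ideal.Quotient.mk I a, Ideal.Quotient.mk I b, h⟩
  refine ⟨IsFractionRing.liftAlgHom (g := g) hg, fun r => ?_⟩
  exact IsFractionRing.lift_algebraMap (g := g.toRingHom) hg (Ideal.Quotient.mk I r)

/-- The polynomial `Y ^ m - (X ^ q - X)` is Eisenstein at `X`. -/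
theorem irreducible_X_pow_sub_C_X_pow_sub_X (k : Type*) [Field k] {m q : ℕ} (hm : 0 < m)
    (hq : 1 < q) : Irreducible (X ^ m - C (X ^ q - X) : k[X][X]) := by
  have hmon : (X ^ m - C (X ^ q - X) : k[X][X]).Monic := monic_X_pow_sub_C _ hm.ne'
  have hdeg : (X ^ m - C (X ^ q - X) : k[X][X]).degree = m := degree_X_pow_sub_C hm _
  have hprime : (Ideal.span {(X : k[X])}).IsPrime :=
    (Ideal.span_singleton_prime X_ne_zero).2 prime_X
  refine irreducible_of_eisenstein_criterion hprime ?_ ?_ ?_ ?_ hmon.isPrimitive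
  · rw [hmon.leadingCoeff, ← Ideal.eq_top_iff_one]
    exact hprime.ne_top
  · intro i hi
    rw [hdeg, Nat.cast_lt] at hi
    rw [Ideal.mem_span_singleton, coeff_sub, coeff_X_pow, if_neg hi.ne, coeff_C]
    split_ifs
    · exact (dvd_zero X).sub ((dvd_pow_self X (by lia)).sub dvd_rfl)
    · simp
  · rw [hdeg]
    exact_mod_cast hm
  · rw [Ideal.span_singleton_pow, Ideal.mem_span_singleton, X_pow_dvd_iff]
    intro h
    have h1 := h 1 one_lt_two
    simp only [coeff_sub, coeff_X_pow, hm.ne, coeff_C_zero, coeff_X_one] at h1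
    simp [hq.ne] at h1

/-- The polynomial relations satisfied by a generic point `(x, y)` of `y ^ m = x ^ q - x` are
the multiples of the defining one. -/
theorem aevalAeval_eq_zero_iff_dvd {k F : Type*} [Field k] [Field F] [Algebra k F] {m q : ℕ}
    (hm : 0 < m) (hq : 1 < q) {x y : F} (hx : Transcendental k x) (hxy : y ^ m = x ^ q - x)
    (f : k[X][X]) :
    aevalAeval (R := k) x y f = 0 ↔ (X ^ m - C (X ^ q - X) : k[X][X]) ∣ f := by
  let _ : Algebra k[X] F := (aeval (R := k) x).toRingHom.toAlgebra
  have : FaithfulSMul k[X] F := (faithfulSMul_iff_algebraMap_injective _ _).2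
    (transcendental_iff_injective.1 hx)
  have hmap (g : k[X]) : algebraMap k[X] F g = aeval x g := rfl
  have haeval : aevalAeval (R := k) x y f = aeval y f := by
    induction f using Polynomial.induction_on' with
    | add a b ha hb => rw [map_add, map_add, ha, hb]
    | monomial i a =>
      rw [← C_mul_X_pow_eq_monomial, map_mul, map_pow, aevalAeval_C, aevalAeval_Y]
      simp [hmap]
  have hmon : (X ^ m - C (X ^ q - X) : k[X][X]).Monic := monic_X_pow_sub_C _ hm.ne'
  have hroot : aeval y (X ^ m - C (X ^ q - X) : k[X][X]) = 0 := by
    simp [hmap, hxy]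
  have hint : IsIntegral k[X] y := ⟨_, hmon, hroot⟩
  have hmin : minpoly k[X] y = X ^ m - C (X ^ q - X) :=
    eq_of_monic_of_associated (minpoly.monic hint) hmon
      ((minpoly.irreducible hint).associated_of_dvd
        (irreducible_X_pow_sub_C_X_pow_sub_X k hm hq) (minpoly.isIntegrallyClosed_dvd hint hroot))
  rw [haeval, minpoly.isIntegrallyClosed_dvd_iff hint, hmin]

/-- A pair of generators of the function field of `y ^ m = x ^ q - x` can be sent to any other
such pair by an automorphism. -/
theorem exists_algEquiv_of_pow_eq {k F : Type*} [Field k] [Field F] [Algebra k F] {m q : ℕ}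
    (hm : 0 < m) (hq : 1 < q) {x y x' y' : F}
    (hx : Transcendental k x) (hxy : y ^ m = x ^ q - x) (hgen : adjoin k {x, y} = ⊤)
    (hx' : Transcendental k x') (hxy' : y' ^ m = x' ^ q - x') (hgen' : adjoin k {x', y'} = ⊤) :
    ∃ σ : F ≃ₐ[k] F, σ x = x' ∧ σ y = y' := by
  have hfrac (z : F) : ∃ a b : k[X][X],
      z = aevalAeval (R := k) x y a / aevalAeval (R := k) x y b := by
    have hle : Algebra.adjoin k {x, y} ≤ (aevalAeval (R := k) x y).range := by
      rw [Algebra.adjoin_le_iff]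
      rintro _ (rfl | rfl)
      · exact ⟨C X, aevalAeval_X _ _⟩
      · exact ⟨X, aevalAeval_Y _ _⟩
    obtain ⟨r, hr, s, hs, rfl⟩ := mem_adjoin_iff_div.1 (hgen ▸ mem_top : z ∈ adjoin k {x, y})
    obtain ⟨a, rfl⟩ := hle hr
    obtain ⟨b, rfl⟩ := hle hs
    exact ⟨a, b, rfl⟩
  obtain ⟨σ, hσ⟩ := exists_algHom_of_ker_eq (aevalAeval (R := k) x y) (aevalAeval (R := k) x' y')
    (fun f => by rw [aevalAeval_eq_zero_iff_dvd hm hq hx hxy,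
      aevalAeval_eq_zero_iff_dvd hm hq hx' hxy']) hfrac
  have hσx : σ x = x' := by simpa only [aevalAeval_X] using hσ (C X)
  have hσy : σ y = y' := by simpa only [aevalAeval_Y] using hσ X
  have hsurj : Function.Surjective σ := by
    rw [← AlgHom.fieldRange_eq_top, eq_top_iff, ← hgen', adjoin_le_iff]
    rintro _ (rfl | rfl)
    · exact ⟨x, hσx⟩
    · exact ⟨y, hσy⟩
  exact ⟨AlgEquiv.ofBijective σ ⟨σ.toRingHom.injective, hsurj⟩, hσx, hσy⟩

/-- A Möbius transformation, together with the matching scaling of `y`, preserves the curve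
`y ^ m = x ^ q - x` when its coefficients transform under Frobenius by a common factor. -/
theorem moebius_pow_sub {F : Type*} [Field F] {m q : ℕ} (hmq : 2 * m = q + 1)
    (hadd : ∀ s t : F, (s + t) ^ q = s ^ q + t ^ q) {x y a b c d r l : F}
    (ha : a ^ q = l * a) (hb : b ^ q = l * b) (hc : c ^ q = l * c) (hd : d ^ q = l * d)
    (hr : r ^ m = l * (a * d - b * c)) (hD : c * x + d ≠ 0) (hxy : y ^ m = x ^ q - x) :
    (r * y / (c * x + d) ^ 2) ^ m =
      ((a * x + b) / (c * x + d)) ^ q - (a * x + b) / (c * x + d) := by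
  have hN : (a * x + b) ^ q = l * (a * x ^ q + b) := by
    rw [hadd, mul_pow, ha, hb]; ring
  have hD' : (c * x + d) ^ q = l * (c * x ^ q + d) := by
    rw [hadd, mul_pow, hc, hd]; ring
  have hDq : (c * x + d) ^ q ≠ 0 := pow_ne_zero _ hD
  rw [div_pow, mul_pow, hr, hxy, ← pow_mul, hmq, pow_succ, div_pow,
    div_sub_div _ _ hDq hD, hN, hD']
  ring

/-- A fractional linear transformation of `x` with nonzero determinant generates the same field
as `x`. -/
theorem mem_of_moebius_mem {k F : Type*} [Field k] [Field F] [Algebra k F]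
    (K : IntermediateField k F) {x : F} {a b c d : k} (hdet : a * d - b * c ≠ 0)
    (hD : algebraMap k F c * x + algebraMap k F d ≠ 0)
    (h : (algebraMap k F a * x + algebraMap k F b) / (algebraMap k F c * x + algebraMap k F d) ∈ K) :
    x ∈ K := by
  set z := (algebraMap k F a * x + algebraMap k F b) / (algebraMap k F c * x + algebraMap k F d)
    with hz
  have hdet' : algebraMap k F a * algebraMap k F d - algebraMap k F b * algebraMap k F c ≠ 0 := by
    simpa using (map_ne_zero (algebraMap k F)).2 hdet
  have hzD : z * (algebraMap k F c * x + algebraMap k F d) =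
      algebraMap k F a * x + algebraMap k F b := by
    rw [hz, div_mul_cancel₀ _ hD]
  have hne : algebraMap k F a - algebraMap k F c * z ≠ 0 := by
    intro h0
    apply hdet'
    by_cases hc : algebraMap k F c = 0
    · have : algebraMap k F a = 0 := by simpa [hc] using h0
      simp [this, hc]
    · linear_combination (algebraMap k F c * x + algebraMap k F d) * h0 +
        algebraMap k F c * hzD
  have hxz : x = (algebraMap k F d * z - algebraMap k F b) /
      (algebraMap k F a - algebraMap k F c * z) := by
    rw [eq_div_iff hne]
    linear_combination -hzD
  rw [hxz]
  exact K.div_mem (K.sub_mem (K.mul_mem (K.algebraMap_mem d) h) (K.algebraMap_mem b))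
    (K.sub_mem (K.algebraMap_mem a) (K.mul_mem (K.algebraMap_mem c) h))

/-- Let `α ∈ 𝔽_{q²} \ 𝔽_q` inside `k` and let `e ∈ k` satisfy
`e^(q+1) = 1`.  Then there is a `k`-algebra automorphism `σ` of `F` with
`σ(x) = ((α - eα^q)x - (1 - e)α^(q+1)) / ((1 - e)x + (-α^q + eα))` and
`σ(y) = e²(α^q - α)² y / ((1 - e)x + (-α^q + eα))²`, and `σ` fixes `u = (x - α)² / y`. -/
theorem stmt_12
    (k : Type*) [Field k] [IsAlgClosed k]
    (p : ℕ) [Fact p.Prime] (hp2 : p ≠ 2) [CharP k p]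
    (n q : ℕ) (hq : q = p ^ n) (hq5 : 5 ≤ q)
    (F : Type*) [Field F] [Algebra k F]
    (x y : F) (hx : Transcendental k x)
    (hxy : y ^ ((q + 1) / 2) = x ^ q - x)
    (hgen : adjoin k {x, y} = ⊤)
    (α : k) (hα : α ^ q ^ 2 = α) (hα' : α ^ q ≠ α)
    (e : k) (he : e ^ (q + 1) = 1)
    (A E : F) (hA : A = algebraMap k F α) (hE : E = algebraMap k F e)
    (u : F) (hu : u = (x - A) ^ 2 / y) :
    ∃ σ : F ≃ₐ[k] F,
      σ x = ((A - E * A ^ q) * x - (1 - E) * A ^ (q + 1))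
              / ((1 - E) * x + (-(A ^ q) + E * A)) ∧
      σ y = E ^ 2 * (A ^ q - A) ^ 2 * y / ((1 - E) * x + (-(A ^ q) + E * A)) ^ 2 ∧
      σ u = u := by
  subst hA hE hu
  have hqodd : Odd q := hq ▸ ((Fact.out : p.Prime).odd_of_ne_two hp2).pow
  have hmq : 2 * ((q + 1) / 2) = q + 1 := Nat.two_mul_div_two_of_even hqodd.add_one
  have hm : 0 < (q + 1) / 2 := by lia
  have hchar : CharP F p := charP_of_injective_algebraMap (algebraMap k F).injective p
  have hfrob (s t : k) : (s + t) ^ q = s ^ q + t ^ q := by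
    rw [hq, add_pow_char_pow]
  have hfrob' (s t : F) : (s + t) ^ q = s ^ q + t ^ q := by
    rw [hq, add_pow_char_pow]
  have hfrob_sub (s t : k) : (s - t) ^ q = s ^ q - t ^ q := by
    rw [hq, sub_pow_char_pow]
  obtain ⟨β, hβ⟩ : ∃ β, β = α ^ q := ⟨_, rfl⟩
  have hβq : β ^ q = α := by rw [hβ, ← pow_mul, ← sq, hα]
  rw [← hβ] at hα'
  have he0 : e ≠ 0 := by
    rintro rfl
    simp at he
  have heq : e ^ q = e⁻¹ := eq_inv_of_mul_eq_one_left (by rw [← pow_succ, he])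
  obtain ⟨a, ha'⟩ : ∃ a, a = α - e * β := ⟨_, rfl⟩
  obtain ⟨b, hb'⟩ : ∃ b, b = -((1 - e) * (α * β)) := ⟨_, rfl⟩
  obtain ⟨c, hc'⟩ : ∃ c, c = 1 - e := ⟨_, rfl⟩
  obtain ⟨d, hd'⟩ : ∃ d, d = -β + e * α := ⟨_, rfl⟩
  obtain ⟨r, hr'⟩ : ∃ r, r = e ^ 2 * (β - α) ^ 2 := ⟨_, rfl⟩
  have hdet : a * d - b * c = e * (β - α) ^ 2 := by
    rw [ha', hb', hc', hd']
    ring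
  have hdet0 : a * d - b * c ≠ 0 := by
    rw [hdet]
    exact mul_ne_zero he0 (pow_ne_zero _ (sub_ne_zero.2 hα'))
  have ha : a ^ q = -e⁻¹ * a := by
    rw [ha', hfrob_sub, mul_pow, heq, hβq, ← hβ]
    field_simp
    ring
  have hb : b ^ q = -e⁻¹ * b := by
    rw [hb', hqodd.neg_pow, mul_pow, mul_pow, hfrob_sub, one_pow, heq, hβq, ← hβ]
    field_simp
    ring
  have hc : c ^ q = -e⁻¹ * c := by
    rw [hc', hfrob_sub, one_pow, heq]
    field_simp
    ring
  have hd : d ^ q = -e⁻¹ * d := by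
    rw [hd', hfrob, hqodd.neg_pow, mul_pow, heq, hβq, ← hβ]
    field_simp
    ring
  have hr : r ^ ((q + 1) / 2) = -e⁻¹ * (a * d - b * c) := by
    rw [hdet, hr', mul_pow, ← pow_mul, ← pow_mul, hmq, he, pow_succ, hfrob_sub, hβq, ← hβ]
    field_simp
    ring
  have hD : algebraMap k F c * x + algebraMap k F d ≠ 0 := by
    intro h0
    have hpoly : aeval x (C c * X + C d) = 0 := by simpa using h0
    have hzero := (transcendental_iff.1 hx) _ hpoly
    have hc0 : c = 0 := by simpa using congrArg (coeff · 1) hzero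
    have hd0 : d = 0 := by simpa using congrArg (coeff · 0) hzero
    exact hdet0 (by simp [hc0, hd0])
  have hr0 : r ≠ 0 := hr' ▸ mul_ne_zero (pow_ne_zero _ he0) (pow_ne_zero _ (sub_ne_zero.2 hα'))
  set x' := (algebraMap k F a * x + algebraMap k F b) / (algebraMap k F c * x + algebraMap k F d)
    with hx'
  set y' := algebraMap k F r * y / (algebraMap k F c * x + algebraMap k F d) ^ 2 with hy'
  have htr : Transcendental k x' := fun halg => hx <|
    mem_algebraicClosure_iff.1 <| mem_of_moebius_mem (algebraicClosure k F) hdet0 hD <|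
      mem_algebraicClosure_iff.2 halg
  have hxy' : y' ^ ((q + 1) / 2) = x' ^ q - x' := by
    refine moebius_pow_sub (l := algebraMap k F (-e⁻¹)) hmq hfrob' ?_ ?_ ?_ ?_ ?_ hD hxy
    · rw [← map_pow, ha, map_mul]
    · rw [← map_pow, hb, map_mul]
    · rw [← map_pow, hc, map_mul]
    · rw [← map_pow, hd, map_mul]
    · rw [← map_pow, hr]
      simp only [map_mul, map_sub]
  have hgen' : adjoin k {x', y'} = ⊤ := by
    have hx'mem : x' ∈ adjoin k {x', y'} := subset_adjoin _ _ (by simp)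
    have hy'mem : y' ∈ adjoin k {x', y'} := subset_adjoin _ _ (by simp)
    have hxmem : x ∈ adjoin k {x', y'} := mem_of_moebius_mem _ hdet0 hD hx'mem
    rw [eq_top_iff, ← hgen, adjoin_le_iff]
    rintro _ (rfl | hy)
    · exact hxmem
    · rw [Set.mem_singleton_iff.1 hy]
      have hyy' : y = y' * (algebraMap k F c * x + algebraMap k F d) ^ 2 / algebraMap k F r := by
        have := (map_ne_zero (algebraMap k F)).2 hr0
        rw [hy']
        field_simp
      rw [SetLike.mem_coe, hyy']
      exact div_mem (mul_mem hy'mem (pow_mem (add_mem (mul_mem (_root_.algebraMap_mem _ c) hxmem)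
        (_root_.algebraMap_mem _ d)) 2)) (_root_.algebraMap_mem _ r)
  obtain ⟨σ, hσx, hσy⟩ := exists_algEquiv_of_pow_eq hm (by lia) hx hxy hgen htr hxy' hgen'
  have hσx' : σ x - algebraMap k F α = algebraMap k F (e * (α - β)) * (x - algebraMap k F α) /
      (algebraMap k F c * x + algebraMap k F d) := by
    rw [hσx, hx', eq_div_iff hD, sub_mul, div_mul_cancel₀ _ hD, ha', hb', hc', hd']
    simp only [map_sub, map_mul, map_add, map_neg, map_one]
    ring
  refine ⟨σ, ?_, ?_, ?_⟩
  · rw [hσx, hx', ha', hb', hc', hd', pow_succ, ← map_pow (algebraMap k F) α, ← hβ]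
    simp only [map_sub, map_mul, map_add, map_neg, map_one]
    ring
  · rw [hσy, hy', hr', hc', hd', ← map_pow (algebraMap k F) α, ← hβ]
    simp only [map_sub, map_mul, map_add, map_neg, map_one, map_pow]
  · have hrF := (map_ne_zero (algebraMap k F)).2 hr0
    have hsq : algebraMap k F (e * (α - β)) ^ 2 = algebraMap k F r := by
      rw [← map_pow, hr']
      congr 1
      ring
    rw [map_div₀, map_pow, map_sub, σ.commutes, hσx', hσy, hy', div_pow, mul_pow, hsq,
      div_div_div_cancel_right₀ (pow_ne_zero _ hD), mul_div_mul_left _ _ hrF]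
end

section
/- Let F' = k(t, y) be the function field of the curve y^(q+1) = t^q − 2·t^((q+1)/2) + t. Then F' is a finite Galois extension of the intermediate field k⟮y/t⟯ generated by k and y/t, and Gal(F'/k⟮y/t⟯) is isomorphic to the additive group of the finite field with q elements. -/
open IntermediateField Polynomial

theorem degree_X_pow_sub_X_sub_C {R : Type*} [CommRing R] [Nontrivial R] {q : ℕ} (hq : 1 < q)
    (c : R) : (X ^ q - X - C c : R[X]).degree = q := by
  rw [sub_sub, degree_sub_eq_left_of_degree_lt, degree_X_pow]
  rw [degree_X_pow, degree_X_add_C]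
  exact_mod_cast hq

theorem monic_X_pow_sub_X_sub_C {R : Type*} [CommRing R] [Nontrivial R] {q : ℕ} (hq : 1 < q)
    (c : R) : (X ^ q - X - C c : R[X]).Monic := by
  rw [sub_sub]
  refine monic_X_pow_sub ?_
  rw [degree_X_add_C]
  exact_mod_cast hq

/-- The Artin-Schreier polynomial `X ^ q - X - T ^ m` is irreducible over `k[T]`: as a polynomial
in `T` over `k[X]` it is Eisenstein at `X`. -/
theorem irreducible_X_pow_sub_X_sub_C_X_pow {k : Type*} [Field k] {q m : ℕ} (hq : 1 < q)
    (hm : 0 < m) : Irreducible (X ^ q - X - C (X ^ m) : k[X][X]) := by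
  have key : Irreducible (X ^ m - C (X ^ q - X) : k[X][X]) := by
    have hmon : (X ^ m - C (X ^ q - X) : k[X][X]).Monic := monic_X_pow_sub_C _ hm.ne'
    have hdeg : (X ^ m - C (X ^ q - X) : k[X][X]).degree = m := degree_X_pow_sub_C hm _
    have hfac : (X ^ q - X : k[X]) = X * (X ^ (q - 1) - 1) := by
      rw [mul_sub, mul_one, ← pow_succ', Nat.sub_add_cancel hq.le]
    refine irreducible_of_eisenstein_criterion (P := Ideal.span {X})
      ((Ideal.span_singleton_prime X_ne_zero).2 prime_X) ?_ (fun i hi => ?_) ?_ ?_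
      hmon.isPrimitive
    · rw [hmon.leadingCoeff, Ideal.mem_span_singleton]
      exact prime_X.not_dvd_one
    · rw [hdeg, Nat.cast_lt] at hi
      rw [Ideal.mem_span_singleton, coeff_sub, coeff_X_pow, if_neg hi.ne, zero_sub, dvd_neg,
        coeff_C]
      split_ifs
      · exact hfac ▸ dvd_mul_right _ _
      · exact dvd_zero _
    · rw [hdeg]
      exact_mod_cast hm
    · rw [coeff_sub, coeff_X_pow, if_neg hm.ne, zero_sub, coeff_C_zero, neg_mem_iff,
        Ideal.span_singleton_pow, Ideal.mem_span_singleton, hfac, pow_two,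
        mul_dvd_mul_iff_left X_ne_zero, X_dvd_iff]
      simp [coeff_X_pow, (Nat.sub_pos_of_lt hq).ne]
  rw [← MulEquiv.irreducible_iff (Bivariate.swap (R := k))]
  have hswap : Bivariate.swap (X ^ q - X - C (X ^ m) : k[X][X]) = -(X ^ m - C (X ^ q - X)) := by
    simp only [map_sub, map_pow, Bivariate.swap_X, Bivariate.swap_Y]
    ring
  rw [hswap]
  exact Associated.irreducible ⟨-1, by simp⟩ key

/-- The Artin-Schreier polynomial `X ^ q - X - u ^ m` is irreducible over `k⟮u⟯` when `u` is
transcendental over `k`. -/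
theorem irreducible_X_pow_sub_X_sub_C_gen_pow {k L : Type*} [Field k] [Field L] [Algebra k L]
    {u : L} (hu : Transcendental k u) {q m : ℕ} (hq : 1 < q) (hm : 0 < m) :
    Irreducible (X ^ q - X - C (AdjoinSimple.gen k u ^ m) : k⟮u⟯[X]) := by
  have h := ((monic_X_pow_sub_X_sub_C hq (X ^ m : k[X])).irreducible_iff_irreducible_map_fraction_map (K := RatFunc k)).1
    (irreducible_X_pow_sub_X_sub_C_X_pow hq hm)
  rw [← MulEquiv.irreducible_iff (mapEquiv (RatFunc.algEquivOfTranscendental u hu).toRingEquiv)] at h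
  have hgen : RatFunc.algEquivOfTranscendental u hu RatFunc.X = AdjoinSimple.gen k u := by
    ext
    simp
  simpa [hgen] using h

/-- An Artin-Schreier extension generated by a root of an irreducible polynomial
`X ^ q - X - c`, over a field containing the field with `q = p ^ n` elements, is Galois with
group the additive group of that finite field. -/
theorem isGalois_and_nonempty_mulEquiv_of_artinSchreier {K L : Type*} [Field K] [Field L]
    [Algebra K L] {p n : ℕ} [Fact p.Prime] [CharP K p] (hn : n ≠ 0) (φ : GaloisField p n →+* K)
    {c : K} (hc : Irreducible (X ^ p ^ n - X - C c : K[X])) {w : L}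
    (hw : w ^ p ^ n - w = algebraMap K L c) (hgen : adjoin K {w} = ⊤) :
    FiniteDimensional K L ∧ IsGalois K L ∧
      Nonempty ((L ≃ₐ[K] L) ≃* Multiplicative (GaloisField p n)) := by
  have hq : 1 < p ^ n := Nat.one_lt_pow hn (Fact.out : p.Prime).one_lt
  have : CharP L p := charP_of_injective_algebraMap (algebraMap K L).injective p
  have hmon : (X ^ p ^ n - X - C c : K[X]).Monic := monic_X_pow_sub_X_sub_C hq c
  have hmin : minpoly K w = X ^ p ^ n - X - C c :=
    (minpoly.eq_of_irreducible_of_monic hc (by simp [hw]) hmon).symm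
  have hint : IsIntegral K w := ⟨_, hmon, by simp [hw]⟩
  have hcard : Nat.card (GaloisField p n) = p ^ n := GaloisField.card p n hn
  have hfin : Finite (GaloisField p n) := Nat.finite_of_card_ne_zero (by omega)
  let pb : PowerBasis K L := PowerBasis.ofAdjoinEqTop hint
    (by rw [← adjoin_simple_toSubalgebra_of_isAlgebraic hint.isAlgebraic, hgen, top_toSubalgebra])
  have hpbgen : pb.gen = w := PowerBasis.ofAdjoinEqTop_gen _ _
  have hfd : FiniteDimensional K L := pb.finite
  have hrank : Module.finrank K L = p ^ n := by
    rw [pb.finrank, ← pb.natDegree_minpoly, hpbgen, hmin]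
    exact natDegree_eq_of_degree_eq_some (degree_X_pow_sub_X_sub_C hq c)
  have hφ (a : GaloisField p n) : φ a ^ p ^ n = φ a := by
    have := Fintype.ofFinite (GaloisField p n)
    rw [← map_pow, ← hcard, Nat.card_eq_fintype_card, FiniteField.pow_card]
  have hroot (a : GaloisField p n) :
      aeval (w + algebraMap K L (φ a)) (minpoly K pb.gen) = 0 := by
    have h := congrArg (algebraMap K L) (hφ a)
    rw [map_pow] at h
    rw [hpbgen, hmin]
    simp only [map_sub, map_pow, aeval_X, aeval_C, add_pow_char_pow, h, ← hw]
    ring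
  have hlift (a : GaloisField p n) : pb.lift _ (hroot a) w = w + algebraMap K L (φ a) := by
    simpa only [hpbgen] using pb.lift_gen _ (hroot a)
  let ψ : Multiplicative (GaloisField p n) →* (L →ₐ[K] L) :=
    { toFun a := pb.lift _ (hroot a.toAdd)
      map_one' := pb.algHom_ext (by rw [hpbgen, hlift]; simp)
      map_mul' a b := pb.algHom_ext (by
        rw [hpbgen, AlgHom.mul_apply, hlift, hlift, map_add, AlgHom.commutes, hlift,
          toAdd_mul, map_add, map_add, add_assoc]) }
  let χ : Multiplicative (GaloisField p n) →* (L ≃ₐ[K] L) :=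
    (algEquivEquivAlgHom K L).symm.toMonoidHom.comp ψ
  have hχ : Function.Injective χ := by
    refine (algEquivEquivAlgHom K L).symm.injective.comp fun a b hab => ?_
    have h := DFunLike.congr_fun hab pb.gen
    simp only [ψ, MonoidHom.coe_mk, OneHom.coe_mk, pb.lift_gen, add_right_inj] at h
    exact Multiplicative.toAdd.injective (φ.injective ((algebraMap K L).injective h))
  have hle : Nat.card (L ≃ₐ[K] L) ≤ p ^ n := by
    rw [← hrank, Nat.card_eq_fintype_card]
    exact AlgEquiv.card_le
  have hcardM : Nat.card (Multiplicative (GaloisField p n)) = p ^ n := hcard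
  have hge : p ^ n ≤ Nat.card (L ≃ₐ[K] L) := hcardM ▸ Nat.card_le_card_of_injective χ hχ
  have hbij : Function.Bijective χ :=
    (Nat.bijective_iff_injective_and_card χ).2 ⟨hχ, by omega⟩
  exact ⟨hfd, IsGalois.of_card_aut_eq_finrank K L (by omega),
    ⟨(MulEquiv.ofBijective χ hbij).symm⟩⟩

/-- A square root `w` of `t⁻¹` in the function field of `y ^ (2 * r + 2) = t (t ^ r - 1) ^ 2`, which
satisfies an Artin-Schreier equation over the field generated by `y / t`. -/
theorem exists_sq_eq_inv_and_pow_sub_self_eq {F : Type*} [Field F] {t y : F} {r : ℕ} (ht : t ≠ 0)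
    (htr : t ^ r ≠ 1) (hty : y ^ (2 * r + 2) = t ^ (2 * r + 1) - 2 * t ^ (r + 1) + t) :
    ∃ w : F, w ^ 2 = t⁻¹ ∧ w ^ (2 * r + 1) - w = (y / t) ^ (r + 1) := by
  have h1 : 1 - t ^ r ≠ 0 := sub_ne_zero.2 htr.symm
  have hsq : ((y / t) ^ (r + 1) * t ^ r / (1 - t ^ r)) ^ 2 = t⁻¹ := by
    have hy : (y ^ (r + 1)) ^ 2 = t * (1 - t ^ r) ^ 2 := by
      rw [← pow_mul, show (r + 1) * 2 = 2 * r + 2 by ring, hty]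
      ring
    rw [div_pow, mul_pow, div_pow, div_pow, hy]
    field_simp
    ring
  refine ⟨_, hsq, ?_⟩
  rw [pow_succ, pow_mul, hsq, inv_pow]
  field_simp

/-- Let `F' = k(t, y)` be the function field of the curve
`y^(q+1) = t^q - 2 t^((q+1)/2) + t`.  Then `F'` is a finite Galois extension of `k⟮y/t⟯`,
and `Gal(F'/k⟮y/t⟯)` is isomorphic to the additive group of the finite field with
`q = pⁿ` elements. -/
theorem stmt_15
    (k : Type*) [Field k] [IsAlgClosed k]
    (p : ℕ) [Fact p.Prime] (hp2 : p ≠ 2) [CharP k p]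
    (n q : ℕ) (hq : q = p ^ n) (hq5 : 5 ≤ q)
    (F' : Type*) [Field F'] [Algebra k F']
    (t y : F') (ht : Transcendental k t)
    (hty : y ^ (q + 1) = t ^ q - 2 * t ^ ((q + 1) / 2) + t)
    (hgen : adjoin k {t, y} = ⊤)
    (u : F') (hu : u = y / t) :
    FiniteDimensional k⟮u⟯ F' ∧ IsGalois k⟮u⟯ F' ∧
      Nonempty ((F' ≃ₐ[k⟮u⟯] F') ≃* Multiplicative (GaloisField p n)) := by
  have hn : n ≠ 0 := by
    rintro rfl
    simp at hq
    omega
  obtain ⟨r, hr⟩ : Odd q := hq ▸ ((Fact.out : p.Prime).odd_of_ne_two hp2).pow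
  have ht0 : t ≠ 0 := fun h => ht (h ▸ isAlgebraic_zero)
  have htr : t ^ r ≠ 1 := fun h =>
    ht.pow (show 0 < r by omega) (h ▸ isAlgebraic_one)
  obtain ⟨w, hwt, hwu⟩ := exists_sq_eq_inv_and_pow_sub_self_eq ht0 htr
    (by rwa [hr, show (2 * r + 1 + 1) / 2 = r + 1 by omega] at hty)
  rw [← hu, ← hr] at hwu
  have hutr : Transcendental k u := by
    intro hualg
    obtain ⟨c, hc⟩ := minpoly.mem_range_of_degree_eq_one k u
      (IsAlgClosed.degree_eq_one_of_irreducible k (minpoly.irreducible hualg.isIntegral))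
    refine ht ?_
    rw [← inv_inv t, ← hwt]
    refine IsAlgebraic.inv (IsAlgebraic.pow ⟨X ^ q - X - C (c ^ (r + 1)),
      (monic_X_pow_sub_X_sub_C (by omega) _).ne_zero, ?_⟩ 2)
    simp [hwu, hc]
  have : CharP k⟮u⟯ p := charP_of_injective_algebraMap (algebraMap k k⟮u⟯).injective p
  let : Algebra (ZMod p) k := ZMod.algebra k p
  let φ : GaloisField p n →+* k⟮u⟯ :=
    (algebraMap k k⟮u⟯).comp (IsAlgClosed.lift : GaloisField p n →ₐ[ZMod p] k).toRingHom
  refine isGalois_and_nonempty_mulEquiv_of_artinSchreier hn φ (w := w)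
    (c := AdjoinSimple.gen k u ^ (r + 1)) ?_ ?_ ?_
  · exact hq ▸ irreducible_X_pow_sub_X_sub_C_gen_pow hutr (by omega) (Nat.succ_pos r)
  · rw [← hq, hwu, map_pow, AdjoinSimple.algebraMap_gen]
  · have hw : w ∈ adjoin k⟮u⟯ {w} := mem_adjoin_simple_self _ _
    have hu' : u ∈ adjoin k⟮u⟯ {w} := IntermediateField.algebraMap_mem _ (AdjoinSimple.gen k u)
    have ht' : t ∈ adjoin k⟮u⟯ {w} := by
      rw [← inv_inv t, ← hwt]
      exact inv_mem (pow_mem hw 2)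
    have hy' : y ∈ adjoin k⟮u⟯ {w} := by
      rw [← div_mul_cancel₀ y ht0, ← hu]
      exact mul_mem hu' ht'
    rw [← restrictScalars_eq_top_iff (K := k), eq_top_iff, ← hgen, adjoin_le_iff]
    rintro x (rfl | rfl)
    exacts [ht', hy']
end
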